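/- (One-step estimate, inequality (24) of the paper.) Let θ ∈ (0,1], σ > 0, let x ∈ dom r, s ∈ ℝ^m, x* ∈ dom r with Aᵀ(Ax* − b) = 0, set z = (1−θ)s + θx, and let x̂ be a minimizer over u ∈ ℝ^m of ⟨∇φ(x) + (σ/θ)∇h(z), u⟩ + r(u) + (1/2)‖u − x‖²_{PT}, with Φ(x̂) finite. Let the random next iterates be x⁺(I) = x + U_I(x̂ − x) and s⁺(I) = z + θ·U_I P(x̂ − x), and let Φ̂ ∈ ℝ and Φ̂⁺ : 𝓘 → ℝ be such that E_{I∼Π}[Φ̂⁺(I)] = (1−θ)·Φ̂ + θ·Φ(x̂), where Φ = φ + r. Then E_{I∼Π}[ (1/θ)(Φ̂⁺(I) − Φ(x*)) + (σ/θ²)(h(s⁺(I)) − h(x*)) + (1/2)‖x⁺(I) − x*‖²_{P²T} ] ≤ ((1−θ)/θ)·(Φ̂ − Φ(x*)) + (σ(1−θ)²/θ²)·(h(s) − h(x*)) + (1/2)‖x − x*‖²_{P²T} − σ·(h(x) − h(x*)) − (1/2)‖x̂ − x‖²_{PT − Λ − σΣ}. -/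

import Mathlib

open Matrix

/-- `h(x) = (1/2)‖Ax − b‖²` written with the dot product. -/
noncomputable def quadH {m q : ℕ} (A : Matrix (Fin q) (Fin m) ℝ) (b : Fin q → ℝ)
    (x : Fin m → ℝ) : ℝ := (1 / 2) * ((A *ᵥ x - b) ⬝ᵥ (A *ᵥ x - b))

/-- `∇h(x) = Aᵀ(Ax − b)`. -/
noncomputable def gradH {m q : ℕ} (A : Matrix (Fin q) (Fin m) ℝ) (b : Fin q → ℝ)
    (x : Fin m → ℝ) : Fin m → ℝ := Aᵀ *ᵥ (A *ᵥ x - b)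

/-- `‖x‖_M² = ⟨Mx, x⟩`. -/
noncomputable def mNormSq {m : ℕ} (M : Matrix (Fin m) (Fin m) ℝ) (x : Fin m → ℝ) : ℝ :=
  (M *ᵥ x) ⬝ᵥ x

/-- `U_I = Σ_{i∈I} U_i`: the 0/1 diagonal matrix selecting the blocks in `I`. -/
def blockUSet {m d : ℕ} (blk : Fin m → Fin d) (I : Finset (Fin d)) :
    Matrix (Fin m) (Fin m) ℝ :=
  Matrix.diagonal (fun j => if blk j ∈ I then 1 else 0)

/-- `p_i = Prob_{I∼Π}(i ∈ I)`. -/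
noncomputable def pblock {d : ℕ} (Pi : Finset (Fin d) → ℝ) (i : Fin d) : ℝ :=
  ∑ I ∈ Finset.univ.filter (fun I : Finset (Fin d) => i ∈ I), Pi I

/-- `P = diag(p_1⁻¹ Id_{m_1},…,p_d⁻¹ Id_{m_d})`. -/
noncomputable def Pmat {m d : ℕ} (blk : Fin m → Fin d) (Pi : Finset (Fin d) → ℝ) :
    Matrix (Fin m) (Fin m) ℝ :=
  Matrix.diagonal (fun j => (pblock Pi (blk j))⁻¹)

/-- `Σ = E_{I∼Π}[U_I P AᵀA P U_I]`. -/
noncomputable def SigmaMat {m q d : ℕ} (A : Matrix (Fin q) (Fin m) ℝ)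
    (blk : Fin m → Fin d) (Pi : Finset (Fin d) → ℝ) : Matrix (Fin m) (Fin m) ℝ :=
  ∑ I : Finset (Fin d),
    Pi I • (blockUSet blk I * Pmat blk Pi * (Aᵀ * A) * Pmat blk Pi * blockUSet blk I)

/-- The continuous linear map `u ↦ v ⬝ᵥ u`, used to express gradients. -/
noncomputable def dotCLM {m : ℕ} (v : Fin m → ℝ) : (Fin m → ℝ) →L[ℝ] ℝ :=
  LinearMap.toContinuousLinearMap
    { toFun := fun u => v ⬝ᵥ u
      map_add' := fun u w => by simp [dotProduct_add]
      map_smul' := fun c u => by simp }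



section QuadraticForms

variable {m q : ℕ}

theorem mNormSq_add {M : Matrix (Fin m) (Fin m) ℝ} (hM : Mᵀ = M) (u v : Fin m → ℝ) :
    mNormSq M (u + v) = mNormSq M u + 2 * ((M *ᵥ u) ⬝ᵥ v) + mNormSq M v := by
  have h : (M *ᵥ v) ⬝ᵥ u = (M *ᵥ u) ⬝ᵥ v := by
    rw [dotProduct_comm, dotProduct_mulVec, ← mulVec_transpose, hM]
  simp only [mNormSq, mulVec_add, add_dotProduct, dotProduct_add, h]
  ring

theorem mNormSq_smul (M : Matrix (Fin m) (Fin m) ℝ) (c : ℝ) (v : Fin m → ℝ) :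
    mNormSq M (c • v) = c ^ 2 * mNormSq M v := by
  simp only [mNormSq, mulVec_smul, smul_dotProduct, dotProduct_smul, smul_eq_mul]
  ring

theorem mNormSq_transpose_mul_mul {n : ℕ} (K : Matrix (Fin n) (Fin n) ℝ)
    (N : Matrix (Fin n) (Fin m) ℝ) (v : Fin m → ℝ) :
    mNormSq (Nᵀ * K * N) v = mNormSq K (N *ᵥ v) := by
  rw [mNormSq, mNormSq, ← mulVec_mulVec, ← mulVec_mulVec, mulVec_transpose, ← dotProduct_mulVec]

theorem mNormSq_transpose_mul_self (A : Matrix (Fin q) (Fin m) ℝ) (v : Fin m → ℝ) :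
    mNormSq (Aᵀ * A) v = (A *ᵥ v) ⬝ᵥ (A *ᵥ v) := by
  rw [mNormSq, ← mulVec_mulVec, mulVec_transpose, ← dotProduct_mulVec]

theorem quadH_add (A : Matrix (Fin q) (Fin m) ℝ) (b : Fin q → ℝ) (z w : Fin m → ℝ) :
    quadH A b (z + w) = quadH A b z + gradH A b z ⬝ᵥ w + (1 / 2) * mNormSq (Aᵀ * A) w := by
  have h : A *ᵥ (z + w) - b = (A *ᵥ z - b) + A *ᵥ w := by rw [mulVec_add]; abel
  rw [mNormSq_transpose_mul_self, gradH, mulVec_transpose, ← dotProduct_mulVec, quadH, quadH, h]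
  simp only [add_dotProduct, dotProduct_add, dotProduct_comm (A *ᵥ w) (A *ᵥ z - b)]
  ring

/-- Around a solution of the normal equations, `h` is a pure quadratic. -/
theorem quadH_sub_of_gradH_eq_zero {A : Matrix (Fin q) (Fin m) ℝ} {b : Fin q → ℝ}
    {y : Fin m → ℝ} (hy : gradH A b y = 0) (v : Fin m → ℝ) :
    quadH A b v - quadH A b y = (1 / 2) * ((A *ᵥ (v - y)) ⬝ᵥ (A *ᵥ (v - y))) := by
  have h := quadH_add A b y (v - y)
  rw [add_sub_cancel, hy, zero_dotProduct, mNormSq_transpose_mul_self] at h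
  linarith

theorem gradH_dotProduct_of_gradH_eq_zero {A : Matrix (Fin q) (Fin m) ℝ} {b : Fin q → ℝ}
    {y : Fin m → ℝ} (hy : gradH A b y = 0) (v w : Fin m → ℝ) :
    gradH A b v ⬝ᵥ w = (A *ᵥ (v - y)) ⬝ᵥ (A *ᵥ w) := by
  have h : gradH A b v = Aᵀ *ᵥ (A *ᵥ (v - y)) + gradH A b y := by
    rw [gradH, gradH, ← mulVec_add, mulVec_sub A v y, sub_add_sub_cancel]
  rw [h, hy, add_zero, mulVec_transpose, ← dotProduct_mulVec]

/-- The exact identity for `h` along the extrapolation `z = (1 - θ) s + θ x`. -/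
theorem quadH_extrapolation {A : Matrix (Fin q) (Fin m) ℝ} {b : Fin q → ℝ}
    {y : Fin m → ℝ} (hy : gradH A b y = 0) (θ : ℝ) (s x : Fin m → ℝ) :
    quadH A b ((1 - θ) • s + θ • x) - quadH A b y
        - θ * (gradH A b ((1 - θ) • s + θ • x) ⬝ᵥ (x - y))
      = (1 - θ) ^ 2 * (quadH A b s - quadH A b y) - θ ^ 2 * (quadH A b x - quadH A b y) := by
  have h : (1 - θ) • s + θ • x - y = (1 - θ) • (s - y) + θ • (x - y) := by module
  simp only [quadH_sub_of_gradH_eq_zero hy, gradH_dotProduct_of_gradH_eq_zero hy, h, mulVec_add,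
    mulVec_smul, add_dotProduct, dotProduct_add, smul_dotProduct, dotProduct_smul, smul_eq_mul,
    dotProduct_comm (A *ᵥ (x - y)) (A *ᵥ (s - y))]
  ring

end QuadraticForms

section BlockSampling

variable {m q d : ℕ} (blk : Fin m → Fin d) (Pi : Finset (Fin d) → ℝ)

/-- A matrix that is block-diagonal for `blk` commutes with matrices that are scalar on blocks. -/
theorem diagonal_comp_mul_comm {M : Matrix (Fin m) (Fin m) ℝ}
    (hM : ∀ j j', blk j ≠ blk j' → M j j' = 0) (f : Fin d → ℝ) :
    diagonal (fun j => f (blk j)) * M = M * diagonal (fun j => f (blk j)) := by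
  ext j j'
  rw [diagonal_mul, mul_diagonal]
  by_cases h : blk j = blk j'
  · rw [h, mul_comm]
  · rw [hM j j' h]; ring

theorem blockUSet_mul_self (I : Finset (Fin d)) :
    blockUSet blk I * blockUSet blk I = blockUSet blk I := by
  simp [blockUSet, diagonal_mul_diagonal]

theorem blockUSet_mul_Pmat (I : Finset (Fin d)) :
    blockUSet blk I * Pmat blk Pi = Pmat blk Pi * blockUSet blk I := by
  simp only [blockUSet, Pmat, diagonal_mul_diagonal, mul_comm]

theorem transpose_blockUSet_mul_Pmat (I : Finset (Fin d)) :
    (blockUSet blk I * Pmat blk Pi)ᵀ = blockUSet blk I * Pmat blk Pi := by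
  rw [transpose_mul, blockUSet_mul_Pmat]
  simp [blockUSet, Pmat]

/-- `E[U_I] = P⁻¹`, in weak form. -/
theorem sum_dotProduct_blockUSet_mulVec (g v : Fin m → ℝ) :
    ∑ I, Pi I * (g ⬝ᵥ (blockUSet blk I *ᵥ v)) = ∑ j, pblock Pi (blk j) * (g j * v j) := by
  simp only [dotProduct, blockUSet, mulVec_diagonal, Finset.mul_sum]
  rw [Finset.sum_comm]
  refine Finset.sum_congr rfl fun j _ => ?_
  rw [pblock, Finset.sum_mul, Finset.sum_filter]
  refine Finset.sum_congr rfl fun I _ => ?_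
  split_ifs <;> ring

variable {Pi}

/-- `E[P U_I] = Id`, in weak form. -/
theorem sum_Pmat_mulVec_dotProduct_blockUSet_mulVec (hp : ∀ i, 0 < pblock Pi i)
    (g v : Fin m → ℝ) :
    ∑ I, Pi I * ((Pmat blk Pi *ᵥ g) ⬝ᵥ (blockUSet blk I *ᵥ v)) = g ⬝ᵥ v := by
  rw [sum_dotProduct_blockUSet_mulVec]
  refine Finset.sum_congr rfl fun j _ => ?_
  rw [Pmat, mulVec_diagonal]
  have := (hp (blk j)).ne'
  field_simp

theorem sum_dotProduct_blockUSet_mul_Pmat_mulVec (hp : ∀ i, 0 < pblock Pi i)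
    (g v : Fin m → ℝ) :
    ∑ I, Pi I * (g ⬝ᵥ ((blockUSet blk I * Pmat blk Pi) *ᵥ v)) = g ⬝ᵥ v := by
  simp only [← mulVec_mulVec]
  rw [sum_dotProduct_blockUSet_mulVec]
  refine Finset.sum_congr rfl fun j _ => ?_
  rw [Pmat, mulVec_diagonal]
  have := (hp (blk j)).ne'
  field_simp

variable (Pi) in
theorem mNormSq_SigmaMat (A : Matrix (Fin q) (Fin m) ℝ) (v : Fin m → ℝ) :
    mNormSq (SigmaMat A blk Pi) v
      = ∑ I, Pi I * mNormSq (Aᵀ * A) ((blockUSet blk I * Pmat blk Pi) *ᵥ v) := by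
  simp only [← mNormSq_transpose_mul_mul, transpose_blockUSet_mul_Pmat]
  rw [mNormSq, SigmaMat, sum_mulVec, sum_dotProduct]
  refine Finset.sum_congr rfl fun I _ => ?_
  rw [smul_mulVec, smul_dotProduct, smul_eq_mul, mNormSq,
    Matrix.mul_assoc _ (Pmat blk Pi) (blockUSet blk I), ← blockUSet_mul_Pmat]

theorem sum_quadH_blockUSet (hsum : ∑ I, Pi I = 1) (hp : ∀ i, 0 < pblock Pi i)
    (A : Matrix (Fin q) (Fin m) ℝ) (b : Fin q → ℝ) (θ : ℝ) (z v : Fin m → ℝ) :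
    ∑ I, Pi I * quadH A b (z + θ • ((blockUSet blk I * Pmat blk Pi) *ᵥ v))
      = quadH A b z + θ * (gradH A b z ⬝ᵥ v)
        + θ ^ 2 / 2 * mNormSq (SigmaMat A blk Pi) v := by
  rw [mNormSq_SigmaMat,
    ← sum_dotProduct_blockUSet_mul_Pmat_mulVec blk hp (gradH A b z) v, Finset.mul_sum,
    Finset.mul_sum, ← one_mul (quadH A b z), ← hsum, Finset.sum_mul, ← Finset.sum_add_distrib,
    ← Finset.sum_add_distrib]
  refine Finset.sum_congr rfl fun I _ => ?_
  rw [quadH_add, mNormSq_smul, dotProduct_smul, smul_eq_mul]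
  ring

theorem sum_mNormSq_add_blockUSet (hsum : ∑ I, Pi I = 1) (hp : ∀ i, 0 < pblock Pi i)
    {M : Matrix (Fin m) (Fin m) ℝ} (hM : Mᵀ = M)
    (hblock : ∀ j j', blk j ≠ blk j' → M j j' = 0) (y v : Fin m → ℝ) :
    ∑ I, Pi I * mNormSq (Pmat blk Pi * M) (y + blockUSet blk I *ᵥ v)
      = mNormSq (Pmat blk Pi * M) y + 2 * ((M *ᵥ y) ⬝ᵥ v) + mNormSq M v := by
  have hPM : Pmat blk Pi * M = M * Pmat blk Pi :=
    diagonal_comp_mul_comm blk hblock fun i => (pblock Pi i)⁻¹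
  have hWt : (Pmat blk Pi * M)ᵀ = Pmat blk Pi * M := by
    rw [transpose_mul, hM, hPM, Pmat, diagonal_transpose]
  have hWU (I : Finset (Fin d)) :
      mNormSq (Pmat blk Pi * M) (blockUSet blk I *ᵥ v)
        = (Pmat blk Pi *ᵥ (M *ᵥ v)) ⬝ᵥ (blockUSet blk I *ᵥ v) := by
    have hUM : blockUSet blk I * M = M * blockUSet blk I :=
      diagonal_comp_mul_comm blk hblock fun i => if i ∈ I then 1 else 0
    have hUt : (blockUSet blk I)ᵀ = blockUSet blk I := diagonal_transpose _
    have hc : Pmat blk Pi * M * blockUSet blk I = blockUSet blk I * (Pmat blk Pi * M) := by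
      rw [Matrix.mul_assoc, ← hUM, ← Matrix.mul_assoc, ← blockUSet_mul_Pmat, Matrix.mul_assoc]
    rw [mNormSq, mulVec_mulVec, hc, ← mulVec_mulVec, dotProduct_mulVec, ← mulVec_transpose, hUt,
      mulVec_mulVec, blockUSet_mul_self, ← mulVec_mulVec v (Pmat blk Pi) M]
    nth_rewrite 1 [← hUt]
    rw [mulVec_transpose, ← dotProduct_mulVec]
  rw [mNormSq.eq_def M v, ← sum_Pmat_mulVec_dotProduct_blockUSet_mulVec blk hp (M *ᵥ v) v,
    ← sum_Pmat_mulVec_dotProduct_blockUSet_mulVec blk hp (M *ᵥ y) v, Finset.mul_sum,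
    ← one_mul (mNormSq (Pmat blk Pi * M) y), ← hsum, Finset.sum_mul, ← Finset.sum_add_distrib,
    ← Finset.sum_add_distrib]
  refine Finset.sum_congr rfl fun I _ => ?_
  rw [mNormSq_add hWt, hWU, ← mulVec_mulVec]
  ring

end BlockSampling

/-- The first-order lower bound for a differentiable convex function. -/
theorem ConvexOn.add_dotProduct_le {m : ℕ} {φ : (Fin m → ℝ) → ℝ}
    (hφ : ConvexOn ℝ Set.univ φ) {x g : Fin m → ℝ} (hg : HasFDerivAt φ (dotCLM g) x)
    (u : Fin m → ℝ) : φ x + g ⬝ᵥ (u - x) ≤ φ u := by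
  have hline : HasDerivAt (φ ∘ AffineMap.lineMap (k := ℝ) x u) (g ⬝ᵥ (u - x)) 0 := by
    have hl : HasDerivAt (AffineMap.lineMap (k := ℝ) x u) (u - x) 0 :=
      AffineMap.hasDerivAt_lineMap
    refine HasFDerivAt.comp_hasDerivAt (l' := dotCLM g) 0 ?_ hl
    simpa using hg
  have hconv : ConvexOn ℝ Set.univ (φ ∘ AffineMap.lineMap (k := ℝ) x u) := by
    simpa using hφ.comp_affineMap (AffineMap.lineMap (k := ℝ) x u)
  have h := hconv.le_slope_of_hasDerivAt (Set.mem_univ 0) (Set.mem_univ 1) one_pos hline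
  simp only [slope_def_field, Function.comp_apply, AffineMap.lineMap_apply_zero,
    AffineMap.lineMap_apply_one, sub_zero, div_one] at h
  linarith

/-- The three-point inequality for a proximal step in the metric of a symmetric matrix. -/
theorem prox_three_point {m : ℕ} {r : (Fin m → ℝ) → EReal}
    (hr : ∀ u v : Fin m → ℝ, ∀ a c : ℝ, 0 ≤ a → 0 ≤ c → a + c = 1 →
      r (a • u + c • v) ≤ (a : EReal) * r u + (c : EReal) * r v)
    {M : Matrix (Fin m) (Fin m) ℝ} (hM : Mᵀ = M) {g x y u : Fin m → ℝ}
    (hmin : ∀ u : Fin m → ℝ,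
      ((g ⬝ᵥ y + (1 / 2) * mNormSq M (y - x) : ℝ) : EReal) + r y
        ≤ ((g ⬝ᵥ u + (1 / 2) * mNormSq M (u - x) : ℝ) : EReal) + r u)
    {ρ ρ' : ℝ} (hρ : r y = (ρ : EReal)) (hρ' : r u = (ρ' : EReal)) :
    g ⬝ᵥ y + (1 / 2) * mNormSq M (y - x) + ρ + (1 / 2) * mNormSq M (u - y)
      ≤ g ⬝ᵥ u + (1 / 2) * mNormSq M (u - x) + ρ' := by
  have hux : mNormSq M (u - x)
      = mNormSq M (y - x) + 2 * ((M *ᵥ (y - x)) ⬝ᵥ (u - y)) + mNormSq M (u - y) := by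
    rw [← mNormSq_add hM]; congr 1; abel
  have key (t : ℝ) (ht : t ∈ Set.Ioo (0 : ℝ) 1) :
      0 ≤ (g ⬝ᵥ u - g ⬝ᵥ y + (M *ᵥ (y - x)) ⬝ᵥ (u - y) + ρ' - ρ)
        + t * ((1 / 2) * mNormSq M (u - y)) := by
    have h1 := (hmin ((1 - t) • y + t • u)).trans
      (add_le_add_right (hr y u (1 - t) t (by linarith [ht.2]) ht.1.le (by ring)) _)
    rw [hρ, hρ'] at h1
    have h2 : (1 - t) • y + t • u - x = (y - x) + t • (u - y) := by module
    rw [h2, mNormSq_add hM, mNormSq_smul] at h1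
    simp only [dotProduct_add, dotProduct_smul, smul_eq_mul] at h1
    norm_cast at h1
    refine nonneg_of_mul_nonneg_right (a := t) ?_ ht.1
    linarith
  have hlim : Filter.Tendsto (fun t : ℝ =>
      (g ⬝ᵥ u - g ⬝ᵥ y + (M *ᵥ (y - x)) ⬝ᵥ (u - y) + ρ' - ρ)
        + t * ((1 / 2) * mNormSq M (u - y))) (nhdsWithin 0 (Set.Ioi 0))
      (nhds ((g ⬝ᵥ u - g ⬝ᵥ y + (M *ᵥ (y - x)) ⬝ᵥ (u - y) + ρ' - ρ)
        + 0 * ((1 / 2) * mNormSq M (u - y)))) :=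
    (Continuous.tendsto (by fun_prop) 0).mono_left nhdsWithin_le_nhds
  have h0 := ge_of_tendsto hlim
    (Filter.mem_of_superset (Ioo_mem_nhdsGT one_pos) key)
  rw [hux]
  linarith

/-- One-step estimate (inequality (24) of the paper) for the randomized block-coordinate
primal-dual algorithm, with `x⁺(I) = x + U_I(x̂ − x)`, `s⁺(I) = z + θ U_I P(x̂ − x)`,
`Φ = φ + r`, `Φ(x̂) = φ(x̂) + ρ` and `Φ(x*) = φ(x*) + ρs`. -/
theorem one_step_estimate {m q d : ℕ}
    (A : Matrix (Fin q) (Fin m) ℝ) (b : Fin q → ℝ)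
    (blk : Fin m → Fin d) (Pi : Finset (Fin d) → ℝ)
    (hPiNonneg : ∀ I, 0 ≤ Pi I) (hPiSum : ∑ I : Finset (Fin d), Pi I = 1)
    (hpPos : ∀ i, 0 < pblock Pi i)
    (r : (Fin m → ℝ) → EReal)
    (hrBot : ∀ u, r u ≠ ⊥) (hrTop : ∃ u, r u ≠ ⊤)
    (hrClosed : LowerSemicontinuous r)
    (hrConvex : ∀ u v : Fin m → ℝ, ∀ a c : ℝ, 0 ≤ a → 0 ≤ c → a + c = 1 →
      r (a • u + c • v) ≤ (a : EReal) * r u + (c : EReal) * r v)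
    (φ : (Fin m → ℝ) → ℝ) (hφConvex : ConvexOn ℝ Set.univ φ)
    (gφ : (Fin m → ℝ) → Fin m → ℝ)
    (hφDiff : ∀ u, HasFDerivAt φ (dotCLM (gφ u)) u)
    (Λ : Matrix (Fin m) (Fin m) ℝ) (hΛpsd : Λ.PosSemidef)
    (hφSmooth : ∀ u v : Fin m → ℝ, r u ≠ ⊤ → r v ≠ ⊤ →
      φ v ≤ φ u + gφ u ⬝ᵥ (v - u) + (1 / 2) * mNormSq Λ (v - u))
    (T : Matrix (Fin m) (Fin m) ℝ)
    (hTblock : ∀ j j' : Fin m, blk j ≠ blk j' → T j j' = 0)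
    (hPT : (Pmat blk Pi * T).PosDef)
    (θ σ : ℝ) (hθ0 : 0 < θ) (hθ1 : θ ≤ 1) (hσ : 0 < σ)
    (x s xstar : Fin m → ℝ)
    (hxdom : r x ≠ ⊤) (hxstardom : r xstar ≠ ⊤)
    (hxstar : Aᵀ *ᵥ (A *ᵥ xstar - b) = 0)
    (z : Fin m → ℝ) (hz : z = (1 - θ) • s + θ • x)
    (xhat : Fin m → ℝ)
    (hmin : ∀ u : Fin m → ℝ,
      (((gφ x + (σ / θ) • gradH A b z) ⬝ᵥ xhat
          + (1 / 2) * mNormSq (Pmat blk Pi * T) (xhat - x) : ℝ) : EReal) + r xhat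
        ≤ (((gφ x + (σ / θ) • gradH A b z) ⬝ᵥ u
          + (1 / 2) * mNormSq (Pmat blk Pi * T) (u - x) : ℝ) : EReal) + r u)
    (ρ : ℝ) (hρ : r xhat = (ρ : EReal))
    (ρs : ℝ) (hρs : r xstar = (ρs : EReal))
    (Φhat : ℝ) (Φhatp : Finset (Fin d) → ℝ)
    (hΦexp : ∑ I : Finset (Fin d), Pi I * Φhatp I
      = (1 - θ) * Φhat + θ * (φ xhat + ρ))
    :
    ∑ I : Finset (Fin d), Pi I *
        ((1 / θ) * (Φhatp I - (φ xstar + ρs))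
          + (σ / θ ^ 2) *
            (quadH A b (z + θ • ((blockUSet blk I * Pmat blk Pi) *ᵥ (xhat - x)))
              - quadH A b xstar)
          + (1 / 2) * mNormSq (Pmat blk Pi * Pmat blk Pi * T)
              (x + blockUSet blk I *ᵥ (xhat - x) - xstar))
      ≤ ((1 - θ) / θ) * (Φhat - (φ xstar + ρs))
        + (σ * (1 - θ) ^ 2 / θ ^ 2) * (quadH A b s - quadH A b xstar)
        + (1 / 2) * mNormSq (Pmat blk Pi * Pmat blk Pi * T) (x - xstar)
        - σ * (quadH A b x - quadH A b xstar)
        - (1 / 2) * mNormSq (Pmat blk Pi * T - Λ - σ • SigmaMat A blk Pi) (xhat - x) := by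
  have hTM (j j' : Fin m) (h : blk j ≠ blk j') : (Pmat blk Pi * T) j j' = 0 := by
    rw [Pmat, diagonal_mul, hTblock j j' h, mul_zero]
  have hMt : (Pmat blk Pi * T)ᵀ = Pmat blk Pi * T := by
    rw [← conjTranspose_eq_transpose_of_trivial]; exact hPT.isHermitian
  have hprox := prox_three_point hrConvex hMt hmin hρ hρs
  have hsmooth := hφSmooth x xhat hxdom (by rw [hρ]; exact EReal.coe_ne_top ρ)
  have hlower := hφConvex.add_dotProduct_le (hφDiff x) xstar
  have hquad := quadH_extrapolation (A := A) (b := b) hxstar θ s x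
  rw [← hz] at hquad
  have hEh := sum_quadH_blockUSet blk hPiSum hpPos A b θ z (xhat - x)
  have hEn := sum_mNormSq_add_blockUSet blk hPiSum hpPos hMt hTM (x - xstar) (xhat - x)
  have hdist : mNormSq (Pmat blk Pi * T) (xstar - xhat)
      = mNormSq (Pmat blk Pi * T) (x - xstar)
        + 2 * (((Pmat blk Pi * T) *ᵥ (x - xstar)) ⬝ᵥ (xhat - x))
        + mNormSq (Pmat blk Pi * T) (xhat - x) := by
    rw [← mNormSq_add hMt, show xstar - xhat = (-1 : ℝ) • (x - xstar + (xhat - x)) by module,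
      mNormSq_smul]
    ring
  have hsymm : mNormSq (Pmat blk Pi * T) (xstar - x)
      = mNormSq (Pmat blk Pi * T) (x - xstar) := by
    rw [show xstar - x = (-1 : ℝ) • (x - xstar) by module, mNormSq_smul]
    ring
  have hexpand : mNormSq (Pmat blk Pi * T - Λ - σ • SigmaMat A blk Pi) (xhat - x)
      = mNormSq (Pmat blk Pi * T) (xhat - x) - mNormSq Λ (xhat - x)
        - σ * mNormSq (SigmaMat A blk Pi) (xhat - x) := by
    simp only [mNormSq, sub_mulVec, smul_mulVec, sub_dotProduct, smul_dotProduct, smul_eq_mul]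
  have hlhs : ∑ I : Finset (Fin d), Pi I *
        ((1 / θ) * (Φhatp I - (φ xstar + ρs))
          + (σ / θ ^ 2) *
            (quadH A b (z + θ • ((blockUSet blk I * Pmat blk Pi) *ᵥ (xhat - x)))
              - quadH A b xstar)
          + (1 / 2) * mNormSq (Pmat blk Pi * Pmat blk Pi * T)
              (x + blockUSet blk I *ᵥ (xhat - x) - xstar))
      = (1 / θ) * (∑ I, Pi I * Φhatp I - (φ xstar + ρs))
        + (σ / θ ^ 2) *
          (∑ I, Pi I * quadH A b (z + θ • ((blockUSet blk I * Pmat blk Pi) *ᵥ (xhat - x)))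
            - quadH A b xstar)
        + (1 / 2) * ∑ I, Pi I * mNormSq (Pmat blk Pi * (Pmat blk Pi * T))
            (x - xstar + blockUSet blk I *ᵥ (xhat - x)) := by
    have hconst (c : ℝ) : c = ∑ I, Pi I * c := by rw [← Finset.sum_mul, hPiSum, one_mul]
    conv_rhs =>
      rw [hconst (φ xstar + ρs), hconst (quadH A b xstar), ← Finset.sum_sub_distrib,
        ← Finset.sum_sub_distrib, Finset.mul_sum, Finset.mul_sum, Finset.mul_sum,
        ← Finset.sum_add_distrib, ← Finset.sum_add_distrib]
    refine Finset.sum_congr rfl fun I _ => ?_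
    rw [Matrix.mul_assoc, add_sub_right_comm]
    ring
  rw [hlhs, hΦexp, hEh, hEn, hexpand, Matrix.mul_assoc]
  have hquad' : (σ / θ ^ 2) * (quadH A b z + θ * (gradH A b z ⬝ᵥ (xhat - x))
        + θ ^ 2 / 2 * mNormSq (SigmaMat A blk Pi) (xhat - x) - quadH A b xstar)
      = (σ * (1 - θ) ^ 2 / θ ^ 2) * (quadH A b s - quadH A b xstar)
        - σ * (quadH A b x - quadH A b xstar)
        + (σ / θ) * (gradH A b z ⬝ᵥ (xhat - xstar))
        + σ / 2 * mNormSq (SigmaMat A blk Pi) (xhat - x) := by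
    simp only [dotProduct_sub] at hquad ⊢
    field_simp
    linear_combination 2 * hquad
  have hΦ : (1 / θ) * ((1 - θ) * Φhat + θ * (φ xhat + ρ) - (φ xstar + ρs))
      = ((1 - θ) / θ) * (Φhat - (φ xstar + ρs)) + (φ xhat + ρ - (φ xstar + ρs)) := by
    field_simp
    ring
  rw [hquad', hΦ]
  simp only [add_dotProduct, smul_dotProduct, smul_eq_mul, dotProduct_sub] at hprox hsmooth hlower hdist ⊢
  linarith
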